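/- Let (L, Q) be a unimodular lattice and w ∈ L a primitive isotropic vector. The short exact sequence 0 → Λ_w → Stab(w) → O(w⊥/ℤw, Q̄) → 0 is exact and split: the map h_w: Stab(w) → O(w⊥/ℤw, Q̄) is surjective and admits a group-theoretic section. -/

import Mathlib

namespace HyperbolicSplitting

variable {L : Type*} [AddCommGroup L] (Q : L →ₗ[ℤ] L →ₗ[ℤ] ℤ) (w u : L)

/-- The orthogonal complement of `ℤ{u, w}`. -/
abbrev perp : Submodule ℤ L := LinearMap.ker (Q.flip u) ⊓ LinearMap.ker (Q.flip w)

variable {Q w u}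

theorem mem_perp {x : L} : x ∈ perp Q w u ↔ Q x u = 0 ∧ Q x w = 0 := by
  simp [perp]

/-- The orthogonal projection of `L` onto the complement of `ℤ{u, w}`, for `w` isotropic
and `Q w u = 1`. -/
def proj (hsymm : ∀ x y, Q x y = Q y x) (hw : Q w w = 0) (hu : Q w u = 1) :
    L →ₗ[ℤ] perp Q w u :=
  LinearMap.codRestrict (perp Q w u)
    (LinearMap.id - (Q.flip w).smulRight u - (Q.flip u - Q u u • Q.flip w).smulRight w)
    fun x => by
      rw [mem_perp]
      constructor
      · simp [hu]
        ring
      · simp [hw, hsymm u w, hu]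

variable (hsymm : ∀ x y, Q x y = Q y x) (hw : Q w w = 0) (hu : Q w u = 1)

theorem proj_apply (x : L) :
    (proj hsymm hw hu x : L) = x - Q x w • u - (Q x u - Q u u * Q x w) • w := by
  simp [proj]

theorem proj_coe (t : perp Q w u) : proj hsymm hw hu (t : L) = t := by
  obtain ⟨h₁, h₂⟩ := mem_perp.1 t.2
  ext
  simp [proj_apply, h₁, h₂]

theorem proj_left : proj hsymm hw hu w = 0 := by
  ext
  simp [proj_apply, hw, hu]

theorem proj_right : proj hsymm hw hu u = 0 := by
  ext
  simp [proj_apply, hsymm u w, hu]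

theorem exists_sub_proj_eq_smul {x : L} (hx : Q x w = 0) :
    ∃ m : ℤ, x - proj hsymm hw hu x = m • w :=
  ⟨Q x u, by simp [proj_apply, hx]⟩

theorem apply_sub_proj_coe (x : L) (t : perp Q w u) :
    Q (x - proj hsymm hw hu x) t = 0 := by
  obtain ⟨h₁, h₂⟩ := mem_perp.1 t.2
  rw [hsymm] at h₁ h₂
  have h : x - (proj hsymm hw hu x : L) = Q x w • u + (Q x u - Q u u * Q x w) • w := by
    rw [proj_apply]; abel
  simp [h, h₁, h₂]

/-- The map induced on `perp Q w u` by an endomorphism of `L`. -/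
def induced (f : L →ₗ[ℤ] L) : perp Q w u →ₗ[ℤ] perp Q w u :=
  proj hsymm hw hu ∘ₗ f ∘ₗ (perp Q w u).subtype

theorem induced_apply (f : L →ₗ[ℤ] L) (t : perp Q w u) :
    induced hsymm hw hu f t = proj hsymm hw hu (f t) := rfl

theorem apply_coe_left_eq_zero {f : L →ₗ[ℤ] L} (hf : ∀ x y, Q (f x) (f y) = Q x y)
    (hfw : f w = w) (t : perp Q w u) : Q (f t) w = 0 := by
  have h := hf t w
  rwa [hfw, (mem_perp.1 t.2).2] at h

theorem exists_sub_induced_eq_smul {f : L →ₗ[ℤ] L} (hf : ∀ x y, Q (f x) (f y) = Q x y)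
    (hfw : f w = w) (t : perp Q w u) :
    ∃ m : ℤ, f t - induced hsymm hw hu f t = m • w :=
  exists_sub_proj_eq_smul hsymm hw hu (apply_coe_left_eq_zero hf hfw t)

theorem induced_isometry {f : L →ₗ[ℤ] L} (hf : ∀ x y, Q (f x) (f y) = Q x y)
    (hfw : f w = w) (x y : perp Q w u) :
    Q (induced hsymm hw hu f x : L) (induced hsymm hw hu f y : L) = Q (x : L) (y : L) := by
  obtain ⟨m, hm⟩ := exists_sub_induced_eq_smul hsymm hw hu hf hfw x
  obtain ⟨n, hn⟩ := exists_sub_induced_eq_smul hsymm hw hu hf hfw y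
  rw [← sub_sub_cancel (f x) (induced hsymm hw hu f x : L),
    ← sub_sub_cancel (f y) (induced hsymm hw hu f y : L), hm, hn]
  simp [apply_coe_left_eq_zero hf hfw, hsymm w (f y), hw, hf]

theorem induced_induced {f f' : L →ₗ[ℤ] L} (hf : ∀ x y, Q (f x) (f y) = Q x y)
    (hfw : f w = w) (hfw' : f' w = w) (h : ∀ x, f' (f x) = x) (t : perp Q w u) :
    induced hsymm hw hu f' (induced hsymm hw hu f t) = t := by
  obtain ⟨m, hm⟩ := exists_sub_induced_eq_smul hsymm hw hu hf hfw t
  have e : (induced hsymm hw hu f t : L) = f t - m • w := by rw [← hm]; abel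
  rw [induced_apply, e, map_sub, map_smul, h, hfw', map_sub, map_smul, proj_left, proj_coe]
  simp

/-- The automorphism of `perp Q w u` induced by an isometry of `L` that fixes `w`. -/
def inducedEquiv (f : L ≃ₗ[ℤ] L) (hf : ∀ x y, Q (f x) (f y) = Q x y) (hfw : f w = w) :
    perp Q w u ≃ₗ[ℤ] perp Q w u :=
  have hfw' : f.symm w = w := by rw [LinearEquiv.symm_apply_eq, hfw]
  LinearEquiv.ofLinearMap (induced hsymm hw hu f) (induced hsymm hw hu f.symm)
    (LinearMap.ext fun t => induced_induced hsymm hw hu (f := f.symm) (f' := f)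
      (fun x y => by simp [← hf (f.symm x)]) hfw' hfw (by simp) t)
    (LinearMap.ext fun t => induced_induced hsymm hw hu (f := f) (f' := f.symm)
      hf hfw hfw' (by simp) t)

/-- The extension of an endomorphism of `perp Q w u` by the identity on `ℤ{u, w}`. -/
def extend (g : perp Q w u →ₗ[ℤ] perp Q w u) : L →ₗ[ℤ] L :=
  LinearMap.id - (perp Q w u).subtype ∘ₗ proj hsymm hw hu +
    (perp Q w u).subtype ∘ₗ g ∘ₗ proj hsymm hw hu

theorem extend_apply (g : perp Q w u →ₗ[ℤ] perp Q w u) (x : L) :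
    extend hsymm hw hu g x = x - proj hsymm hw hu x + g (proj hsymm hw hu x) := rfl

theorem extend_extend (g₁ g₂ : perp Q w u →ₗ[ℤ] perp Q w u) (x : L) :
    extend hsymm hw hu g₁ (extend hsymm hw hu g₂ x) = extend hsymm hw hu (g₁ ∘ₗ g₂) x := by
  simp [extend_apply, proj_coe]

theorem extend_id (x : L) : extend hsymm hw hu LinearMap.id x = x := by
  simp [extend_apply]

theorem extend_isometry {g : perp Q w u →ₗ[ℤ] perp Q w u}
    (hg : ∀ x y : perp Q w u, Q (g x : L) (g y : L) = Q (x : L) (y : L)) (x y : L) :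
    Q (extend hsymm hw hu g x) (extend hsymm hw hu g y) = Q x y := by
  have key (a b : perp Q w u) : Q (x - proj hsymm hw hu x + a) (y - proj hsymm hw hu y + b) =
      Q (x - proj hsymm hw hu x) (y - proj hsymm hw hu y) + Q (a : L) b := by
    rw [map_add, map_add, LinearMap.add_apply, LinearMap.add_apply, apply_sub_proj_coe,
      hsymm a (y - _), apply_sub_proj_coe]
    ring
  rw [extend_apply, extend_apply, key, hg, ← key, sub_add_cancel, sub_add_cancel]

/-- The extension of an automorphism of `perp Q w u` by the identity on `ℤ{u, w}`. -/
def extendEquiv (g : perp Q w u ≃ₗ[ℤ] perp Q w u) : L ≃ₗ[ℤ] L :=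
  LinearEquiv.ofLinearMap (extend hsymm hw hu g) (extend hsymm hw hu g.symm)
    (LinearMap.ext fun x => by simp [extend_extend, extend_id])
    (LinearMap.ext fun x => by simp [extend_extend, extend_id])

theorem extendEquiv_apply (g : perp Q w u ≃ₗ[ℤ] perp Q w u) (x : L) :
    extendEquiv hsymm hw hu g x = extend hsymm hw hu g x := rfl

end HyperbolicSplitting

open HyperbolicSplitting

/-- The sequence `0 → Λ_w → Stab(w) → O(w⊥/ℤw, Q̄) → 0` is exact and
split. Via the orthogonal splitting `L = ℤ{u,w} ⊕ T` with `T = ℤ{u,w}⊥ ≅ w⊥/ℤw`: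
every `f ∈ Stab(w)` induces an isometry `g` of `T` (the map `h_w`, and its kernel
is exactly `Λ_w`, i.e. those `f` with `g = id`), and there is a multiplicative
section `σ` sending an isometry of `T` to an isometry of `L` fixing `w` and `u`
and extending it. -/
theorem stmt_6 {L : Type*} [AddCommGroup L] [Module.Free ℤ L] [Module.Finite ℤ L]
    (Q : L →ₗ[ℤ] L →ₗ[ℤ] ℤ)
    (hsymm : ∀ x y, Q x y = Q y x)
    (hunimod : ∀ φ : L →ₗ[ℤ] ℤ, ∃! y : L, ∀ x, Q y x = φ x)
    (w : L) (hwiso : Q w w = 0)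
    (hprim : ∀ (a : ℤ) (x : L), a • x = w → IsUnit a)
    (u : L) (hu : Q w u = 1) :
    let T : Submodule ℤ L := LinearMap.ker (Q.flip u) ⊓ LinearMap.ker (Q.flip w)
    -- h_w : Stab(w) → O(w⊥/ℤw, Q̄) in the T-model, with kernel Λ_w
    (∀ f : L ≃ₗ[ℤ] L, (∀ x y, Q (f x) (f y) = Q x y) → f w = w →
      ∃ g : T ≃ₗ[ℤ] T,
        (∀ x y : T, Q (g x : L) (g y : L) = Q (x : L) (y : L)) ∧
        (∀ x : T, ∃ m : ℤ, f (x : L) - (g x : L) = m • w) ∧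
        ((∀ x : T, g x = x) ↔ ∀ e, Q w e = 0 → ∃ m : ℤ, f e - e = m • w)) ∧
    -- a multiplicative section σ
    (∃ σ : (T ≃ₗ[ℤ] T) → (L ≃ₗ[ℤ] L),
      (∀ g : T ≃ₗ[ℤ] T, (∀ x y : T, Q (g x : L) (g y : L) = Q (x : L) (y : L)) →
        (∀ x y, Q (σ g x) (σ g y) = Q x y) ∧ σ g w = w ∧ σ g u = u ∧
        ∀ x : T, σ g (x : L) = (g x : L)) ∧
      (∀ g₁ g₂ : T ≃ₗ[ℤ] T,
        (∀ x y : T, Q (g₁ x : L) (g₁ y : L) = Q (x : L) (y : L)) →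
        (∀ x y : T, Q (g₂ x : L) (g₂ y : L) = Q (x : L) (y : L)) →
        ∀ x, σ (g₂.trans g₁) x = σ g₁ (σ g₂ x))) := by
  intro T
  refine ⟨fun f hf hfw => ?_, extendEquiv hsymm hwiso hu,
    fun g hg => ⟨extend_isometry hsymm hwiso hu hg, ?_, ?_, fun x => ?_⟩,
    fun g₁ g₂ _ _ x => (extend_extend hsymm hwiso hu g₁ g₂ x).symm⟩
  · have hsub := exists_sub_induced_eq_smul hsymm hwiso hu (f := f) hf hfw
    refine ⟨inducedEquiv hsymm hwiso hu f hf hfw,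
      induced_isometry hsymm hwiso hu (f := f) hf hfw, hsub, fun h e he => ?_, fun h x => ?_⟩
    · obtain ⟨m, hm⟩ := exists_sub_proj_eq_smul hsymm hwiso hu ((hsymm e w).trans he)
      set t := proj hsymm hwiso hu e
      obtain ⟨n, hn⟩ := hsub t
      have ht : induced hsymm hwiso hu f t = t := h t
      rw [ht] at hn
      have he' : e = m • w + t := by rw [← hm]; abel
      refine ⟨n, hn ▸ ?_⟩
      rw [he', map_add, map_smul, hfw, add_sub_add_left_eq_sub]
      rfl
    · obtain ⟨m, hm⟩ := h x (by rw [hsymm, (mem_perp.1 x.2).2])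
      change proj hsymm hwiso hu (f x) = x
      rw [sub_eq_iff_eq_add.1 hm, map_add, map_smul, proj_left, smul_zero,
        zero_add, proj_coe]
  · simp [extendEquiv_apply, extend_apply, proj_left]
  · simp [extendEquiv_apply, extend_apply, proj_right]
  · simp [extendEquiv_apply, extend_apply, proj_coe]
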